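/- Let μ and ν be probability measures on ℝ with μ absolutely continuous with respect to the Lebesgue measure. Then the map T := F_ν† ∘ F_μ pushes μ forward to ν, i.e. T_#μ = ν. -/

import Mathlib

open MeasureTheory Set

/-- The cumulative distribution function (CDF) of a measure `ν` on `ℝ`. -/
noncomputable def Fcdf (ν : Measure ℝ) (x : ℝ) : ℝ := (ν (Iic x)).toReal

/-- The generalized inverse (quantile function) of the CDF of `ν`. -/
noncomputable def Fq (ν : Measure ℝ) (y : ℝ) : ℝ := sInf {x : ℝ | Fcdf ν x > y}

/-- The Lebesgue measure restricted to `[0,1]` (the uniform measure on `[0,1]`). -/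
noncomputable def unif : Measure ℝ := volume.restrict (Icc (0:ℝ) 1)

open ProbabilityTheory Filter Topology

lemma Fcdf_eq_cdf (ν : Measure ℝ) [IsProbabilityMeasure ν] (x : ℝ) : Fcdf ν x = cdf ν x := by
  rw [cdf_eq_real]; rfl

lemma continuous_cdf (μ : Measure ℝ) [IsProbabilityMeasure μ] [NullSingletonClass μ] :
    Continuous (cdf μ) := by
  refine continuous_iff_continuousAt.2 fun a => ?_
  rw [(cdf μ).mono.continuousAt_iff_leftLim_eq_rightLim, (cdf μ).rightLim_eq]
  refine le_antisymm ((cdf μ).mono.leftLim_le le_rfl) ?_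
  have h := (cdf μ).measure_singleton a
  rw [measure_cdf, measure_singleton, eq_comm, ENNReal.ofReal_eq_zero] at h
  linarith

section CdfLevels

variable (μ : Measure ℝ) [IsProbabilityMeasure μ] [NullSingletonClass μ]

lemma exists_cdf_eq {t : ℝ} (h0 : 0 < t) (h1 : t < 1) : ∃ a, cdf μ a = t := by
  obtain ⟨a, ha⟩ := ((tendsto_cdf_atBot μ).eventually_lt_const h0).exists
  obtain ⟨b, hb⟩ := ((tendsto_cdf_atTop μ).eventually_const_lt h1).exists
  exact mem_range_of_exists_le_of_exists_ge (continuous_cdf μ) ⟨a, ha.le⟩ ⟨b, hb.le⟩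

lemma measureReal_cdf_lt_le {t : ℝ} (h0 : 0 < t) : μ.real {x | cdf μ x < t} ≤ t := by
  rcases lt_or_ge t 1 with h1 | h1
  · obtain ⟨a, rfl⟩ := exists_cdf_eq μ h0 h1
    conv_rhs => rw [cdf_eq_real]
    exact measureReal_mono fun x hx => ((monotone_cdf μ).reflect_lt hx).le
  · exact measureReal_le_one.trans h1

lemma le_measureReal_cdf_le {t : ℝ} (h1 : t < 1) : t ≤ μ.real {x | cdf μ x ≤ t} := by
  rcases lt_or_ge 0 t with h0 | h0
  · obtain ⟨a, rfl⟩ := exists_cdf_eq μ h0 h1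
    conv_lhs => rw [cdf_eq_real]
    exact measureReal_mono fun x hx => monotone_cdf μ hx
  · exact h0.trans measureReal_nonneg

lemma measureReal_cdf_le_le {t : ℝ} (h0 : 0 ≤ t) : μ.real {x | cdf μ x ≤ t} ≤ t :=
  le_of_forall_gt_imp_ge_of_dense fun _ hs =>
    (measureReal_mono fun _ hx => lt_of_le_of_lt hx hs).trans
      (measureReal_cdf_lt_le μ (h0.trans_lt hs))

lemma le_measureReal_cdf_lt {t : ℝ} (h1 : t ≤ 1) : t ≤ μ.real {x | cdf μ x < t} :=
  le_of_forall_lt_imp_le_of_dense fun _ hs =>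
    (le_measureReal_cdf_le μ (hs.trans_le h1)).trans
      (measureReal_mono fun _ hx => lt_of_le_of_lt hx hs)

lemma ae_cdf_mem_Ioo : ∀ᵐ x ∂μ, cdf μ x ∈ Ioo (0 : ℝ) 1 := by
  have hpos : ∀ᵐ x ∂μ, 0 < cdf μ x := by
    have h := le_antisymm (measureReal_cdf_le_le μ le_rfl) measureReal_nonneg
    rw [measureReal_eq_zero_iff] at h
    simpa [ae_iff] using h
  have hlt : ∀ᵐ x ∂μ, cdf μ x < 1 := by
    have h := le_antisymm measureReal_le_one (le_measureReal_cdf_lt μ le_rfl)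
    have hm : MeasurableSet {x | cdf μ x < 1} :=
      measurableSet_lt (monotone_cdf μ).measurable measurable_const
    exact (prob_compl_eq_zero_iff hm).2
      (by simpa [measureReal_def, ENNReal.toReal_eq_one_iff] using h)
  filter_upwards [hpos, hlt] with x h0 h1 using ⟨h0, h1⟩

end CdfLevels

section Quantile

variable (ν : Measure ℝ) [IsProbabilityMeasure ν] {y : ℝ}

lemma bddBelow_setOf_lt_Fcdf (h0 : 0 < y) : BddBelow {x : ℝ | Fcdf ν x > y} := by
  obtain ⟨a, ha⟩ := ((tendsto_cdf_atBot ν).eventually_lt_const h0).exists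
  refine ⟨a, fun x hx => ?_⟩
  rw [mem_ofPred_eq, Fcdf_eq_cdf] at hx
  exact ((monotone_cdf ν).reflect_lt (ha.trans hx)).le

lemma nonempty_setOf_lt_Fcdf (h1 : y < 1) : {x : ℝ | Fcdf ν x > y}.Nonempty := by
  obtain ⟨b, hb⟩ := ((tendsto_cdf_atTop ν).eventually_const_lt h1).exists
  exact ⟨b, by rwa [mem_ofPred_eq, Fcdf_eq_cdf]⟩

lemma Fq_le_of_lt_cdf (h0 : 0 < y) {z : ℝ} (h : y < cdf ν z) : Fq ν y ≤ z :=
  csInf_le (bddBelow_setOf_lt_Fcdf ν h0) (by rwa [mem_ofPred_eq, Fcdf_eq_cdf])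

lemma le_cdf_of_Fq_le (h1 : y < 1) {z : ℝ} (h : Fq ν y ≤ z) : y ≤ cdf ν z := by
  refine ge_of_tendsto (((cdf ν).right_continuous z).mono Ioi_subset_Ici_self)
    (eventually_mem_nhdsWithin.mono fun w hw => ?_)
  obtain ⟨x, hx, hxw⟩ := exists_lt_of_csInf_lt (nonempty_setOf_lt_Fcdf ν h1) (h.trans_lt hw)
  rw [mem_ofPred_eq, Fcdf_eq_cdf] at hx
  exact hx.le.trans (monotone_cdf ν hxw.le)

lemma monotoneOn_Fq : MonotoneOn (Fq ν) (Ioo 0 1) := fun _ ha _ hb hab =>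
  csInf_le_csInf (bddBelow_setOf_lt_Fcdf ν ha.1) (nonempty_setOf_lt_Fcdf ν hb.2)
    fun _ hx => lt_of_le_of_lt hab hx

end Quantile

/-- If `μ ≪ Leb`, the map `T = F_ν† ∘ F_μ` pushes `μ` forward to `ν`. -/
theorem monotone_rearrangement_pushforward (μ ν : Measure ℝ)
    [IsProbabilityMeasure μ] [IsProbabilityMeasure ν] (hac : μ ≪ volume) :
    Measure.map (fun x => Fq ν (Fcdf μ x)) μ = ν := by
  have : NullSingletonClass μ := ⟨fun a => hac (measure_singleton a)⟩
  have hae := ae_cdf_mem_Ioo μ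
  simp only [Fcdf_eq_cdf]
  have hmeas : AEMeasurable (fun x => Fq ν (cdf μ x)) μ := by
    have h := aemeasurable_restrict_of_monotoneOn (μ := μ) (f := fun x => Fq ν (cdf μ x))
      ((monotone_cdf μ).measurable measurableSet_Ioo)
      fun a ha b hb hab => monotoneOn_Fq ν ha hb (monotone_cdf μ hab)
    rwa [Measure.restrict_eq_self_of_ae_mem (s := cdf μ ⁻¹' Ioo 0 1) hae] at h
  have := Measure.isProbabilityMeasure_map hmeas
  refine Measure.ext_of_Iic _ _ fun z => ?_
  rw [Measure.map_apply_of_aemeasurable hmeas measurableSet_Iic,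
    ← measureReal_eq_measureReal_iff, ← cdf_eq_real ν]
  refine le_antisymm (le_trans ?_ (measureReal_cdf_le_le μ (cdf_nonneg ν z)))
    ((le_measureReal_cdf_lt μ (cdf_le_one ν z)).trans ?_)
  · refine ENNReal.toReal_mono (measure_ne_top _ _) (measure_mono_ae ?_)
    filter_upwards [hae] with x hx using le_cdf_of_Fq_le ν hx.2
  · refine ENNReal.toReal_mono (measure_ne_top _ _) (measure_mono_ae ?_)
    filter_upwards [hae] with x hx using Fq_le_of_lt_cdf ν hx.1
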